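/- Let F be a field and let f ∈ F⟦z⟧ be a formal power series with nonzero constant term (so that f is invertible in F⟦z⟧). For every integer n ≥ 1, the Hasse–Teichmüller derivative satisfies H^(n)(1/f) = ∑_{k=1}^{n} (-1)^k / f^{k+1} · ∑_{i_1,…,i_k ≥ 1, i_1+⋯+i_k = n} H^(i_1)(f) ⋯ H^(i_k)(f), where the inner sum is over all ordered k-tuples of positive integers summing to n. -/

import Mathlib

noncomputable section

/-- The Hasse–Teichmüller derivative `H^(n)` of order `n` on `F⟦z⟧`: the `m`-th coefficient of
`H^(n) f` is `C(m+n, n)` times the `(m+n)`-th coefficient of `f`. -/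
def hasseTeich (F : Type*) [Field F] (n : ℕ) (f : PowerSeries F) : PowerSeries F :=
  PowerSeries.mk fun m : ℕ => ((m + n).choose n : F) * PowerSeries.coeff (m + n) f

theorem hasseTeich_mul (F : Type*) [Field F] (n : ℕ) (f g : PowerSeries F) :
    hasseTeich F n (f * g)
      = ∑ p ∈ Finset.HasAntidiagonal.antidiagonal n, hasseTeich F p.1 f * hasseTeich F p.2 g := by
  ext m
  have key : ∀ (h : PowerSeries F) (i a : ℕ), a + i < m + n + 1 →
      PowerSeries.coeff a (hasseTeich F i h)
        = (Polynomial.hasseDeriv i (PowerSeries.trunc (m + n + 1) h)).coeff a := by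
    intro h i a hia
    rw [Polynomial.hasseDeriv_coeff, PowerSeries.coeff_trunc, if_pos hia, hasseTeich,
      PowerSeries.coeff_mk]
  have h1 : PowerSeries.coeff m (hasseTeich F n (f * g))
      = (Polynomial.hasseDeriv n (PowerSeries.trunc (m + n + 1) f *
          PowerSeries.trunc (m + n + 1) g)).coeff m := by
    rw [Polynomial.hasseDeriv_coeff, hasseTeich, PowerSeries.coeff_mk,
      PowerSeries.coeff_mul_eq_coeff_trunc_mul_trunc f g (Nat.lt_succ_self (m + n)),
      ← Polynomial.coe_mul, Polynomial.coeff_coe]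
  rw [h1, Polynomial.hasseDeriv_mul, Polynomial.finsetSum_coeff, map_sum]
  refine Finset.sum_congr rfl fun p hp => ?_
  rw [Polynomial.coeff_mul, PowerSeries.coeff_mul]
  refine Finset.sum_congr rfl fun q hq => ?_
  rw [Finset.HasAntidiagonal.mem_antidiagonal] at hp hq
  rw [key f p.1 q.1 (by omega), key g p.2 q.2 (by omega)]

theorem sum_tuple_succ {M : Type*} [AddCommMonoid M] (k n : ℕ) (g : (Fin (k + 1) → ℕ) → M) :
    ∑ x ∈ Finset.Nat.antidiagonalTuple (k + 1) n, g x
      = ∑ p ∈ Finset.HasAntidiagonal.antidiagonal n, ∑ x ∈ Finset.Nat.antidiagonalTuple k p.2,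
          g (Fin.cons p.1 x) := by
  rw [Finset.sum_sigma']
  refine Finset.sum_bij' (fun x _ => ⟨(x 0, ∑ j, x (Fin.succ j)), Fin.tail x⟩)
    (fun y _ => Fin.cons y.1.1 y.2) ?_ ?_ ?_ ?_ ?_
  · intro x hx
    rw [Finset.Nat.mem_antidiagonalTuple, Fin.sum_univ_succ] at hx
    simp [Finset.Nat.mem_antidiagonalTuple, hx, Fin.tail]
  · rintro ⟨⟨a, b⟩, x⟩ hx
    simp only [Finset.mem_sigma, Finset.HasAntidiagonal.mem_antidiagonal, Finset.Nat.mem_antidiagonalTuple] at hx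
    simp [Finset.Nat.mem_antidiagonalTuple, Fin.sum_univ_succ, hx.1, hx.2]
  · intro x hx
    exact Fin.cons_self_tail x
  · rintro ⟨⟨a, b⟩, x⟩ hx
    simp only [Finset.mem_sigma, Finset.HasAntidiagonal.mem_antidiagonal, Finset.Nat.mem_antidiagonalTuple] at hx
    simp [hx.2]
  · intro x hx
    simp

theorem coeff_pow_tuple {A : Type*} [CommRing A] (D : PowerSeries A) (k n : ℕ) :
    PowerSeries.coeff n (D ^ k)
      = ∑ x ∈ Finset.Nat.antidiagonalTuple k n, ∏ j, PowerSeries.coeff (x j) D := by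
  induction k generalizing n with
  | zero =>
    cases n with
    | zero => simp
    | succ n => simp [PowerSeries.coeff_one]
  | succ k ih =>
    rw [pow_succ', PowerSeries.coeff_mul, sum_tuple_succ]
    refine Finset.sum_congr rfl fun p _ => ?_
    rw [ih, Finset.mul_sum]
    refine Finset.sum_congr rfl fun x _ => ?_
    rw [Fin.prod_univ_succ]
    simp

theorem geom_aux {A : Type*} [CommRing A] (G D u : A) (h : G = u - u * D * G) (N : ℕ) :
    G = ∑ k ∈ Finset.range N, (-1) ^ k * u ^ (k + 1) * D ^ k
      + (-1) ^ N * u ^ N * D ^ N * G := by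
  induction N with
  | zero => simp
  | succ N ih =>
    rw [Finset.sum_range_succ]
    linear_combination ih + (-1) ^ N * u ^ N * D ^ N * h

/-- Quotient rule:
`H^(n)(1/f) = ∑_{k=1}^n (-1)^k / f^{k+1} ∑_{i_1+⋯+i_k=n, i_j ≥ 1} H^(i_1)(f) ⋯ H^(i_k)(f)`. -/
theorem hasseTeich_inv (F : Type*) [Field F] (f : PowerSeries F)
    (hf : PowerSeries.constantCoeff f ≠ 0) (n : ℕ) (hn : 1 ≤ n) :
    hasseTeich F n f⁻¹
      = ∑ k ∈ Finset.Icc 1 n,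
          (-1) ^ k * (f ^ (k + 1))⁻¹ *
            ∑ i ∈ (Finset.Nat.antidiagonalTuple k n).filter fun i => ∀ j, 1 ≤ i j,
              ∏ j, hasseTeich F (i j) f := by
  have hinv : f * f⁻¹ = 1 := PowerSeries.mul_inv_cancel f hf
  have hpow : ∀ k : ℕ, (f ^ k)⁻¹ = f⁻¹ ^ k := by
    intro k
    rw [PowerSeries.inv_eq_iff_mul_eq_one (by simpa using fun h => absurd h hf), ← mul_pow,
      mul_comm, hinv, one_pow]
  let D : PowerSeries (PowerSeries F) :=
    PowerSeries.mk fun i => if i = 0 then 0 else hasseTeich F i f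
  let G : PowerSeries (PowerSeries F) := PowerSeries.mk fun i => hasseTeich F i f⁻¹
  have h0 : ∀ g : PowerSeries F, hasseTeich F 0 g = g := by
    intro g; ext m; simp [hasseTeich]
  have hT : PowerSeries.C f + D = PowerSeries.mk fun i => hasseTeich F i f := by
    ext1 i
    by_cases hi : i = 0
    · subst hi; simp [D, h0]
    · simp [D, hi, PowerSeries.coeff_C]
  have hTG : (PowerSeries.C f + D) * G = 1 := by
    rw [hT]
    ext1 i
    rw [PowerSeries.coeff_mul]
    simp only [G, PowerSeries.coeff_mk]
    rw [← hasseTeich_mul, hinv]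
    ext m
    by_cases hi : i = 0
    · subst hi; simp [h0]
    · simp [hasseTeich, PowerSeries.coeff_one, hi]
  have hC : (PowerSeries.C f⁻¹ : PowerSeries (PowerSeries F)) * PowerSeries.C f = 1 := by
    rw [← map_mul, mul_comm, hinv, map_one]
  have hG : G = PowerSeries.C f⁻¹ - PowerSeries.C f⁻¹ * D * G := by
    linear_combination PowerSeries.C f⁻¹ * hTG - G * hC
  have hgeom := geom_aux G D _ hG (n + 1)
  have hX : PowerSeries.X ∣ D := by
    rw [PowerSeries.X_dvd_iff]; simp [D]
  have hlast : PowerSeries.coeff n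
      ((-1) ^ (n + 1) * PowerSeries.C f⁻¹ ^ (n + 1) * D ^ (n + 1) * G) = 0 := by
    have : PowerSeries.X ^ (n + 1) ∣
        ((-1) ^ (n + 1) * PowerSeries.C f⁻¹ ^ (n + 1) * D ^ (n + 1) * G) :=
      Dvd.dvd.mul_right (Dvd.dvd.mul_left (pow_dvd_pow_of_dvd hX _) _) _
    exact PowerSeries.X_pow_dvd_iff.mp this n (Nat.lt_succ_self n)
  have hcoef := congrArg (PowerSeries.coeff n) hgeom
  rw [map_add, hlast, add_zero, map_sum, Finset.sum_range_succ'] at hcoef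
  have hz : PowerSeries.coeff n
      ((-1) ^ 0 * PowerSeries.C f⁻¹ ^ (0 + 1) * D ^ 0) = 0 := by
    have : n ≠ 0 := by omega
    simp [PowerSeries.coeff_C, this]
  rw [hz, add_zero] at hcoef
  have hGn : PowerSeries.coeff n G = hasseTeich F n f⁻¹ := by simp [G]
  rw [← hGn, hcoef, Finset.range_eq_Ico, Finset.sum_Ico_add' (fun k => PowerSeries.coeff n
    ((-1) ^ k * PowerSeries.C f⁻¹ ^ (k + 1) * D ^ k)) 0 n 1]
  have hI : Finset.Ico (0 + 1) (n + 1) = Finset.Icc 1 n := by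
    ext; simp
  rw [hI]
  refine Finset.sum_congr rfl fun k _ => ?_
  have hc : ((-1) ^ k * PowerSeries.C f⁻¹ ^ (k + 1) : PowerSeries (PowerSeries F))
      = PowerSeries.C ((-1) ^ k * f⁻¹ ^ (k + 1)) := by simp
  rw [hc, PowerSeries.coeff_C_mul, hpow, coeff_pow_tuple]
  congr 1
  rw [← Finset.sum_filter_of_ne (p := fun i : Fin k → ℕ => ∀ j, 1 ≤ i j)]
  · refine Finset.sum_congr rfl fun x hx => Finset.prod_congr rfl fun j _ => ?_
    have := (Finset.mem_filter.mp hx).2 j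
    have : x j ≠ 0 := by omega
    simp [D, this]
  · intro x _ hne j
    by_contra hj
    have : x j = 0 := by omega
    exact hne (Finset.prod_eq_zero (Finset.mem_univ j) (by simp [D, this]))

end
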